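/- For all n ≤ m, W_{n,m} = span_F{ P_O : O ∈ Ω_{n,m} }: the space W_{n,m} is spanned by the polynomials P_n(x_{A_1},...,x_{A_n}), where {A_1,...,A_n} ranges over all ordered partitions of [m] into n parts. -/

import Mathlib

noncomputable section

/-- The free non-unital associative algebra over `F` on countably many generators
`x_0, x_1, x_2, …`, realized as the semigroup algebra of the free semigroup on `ℕ`. -/
abbrev FreeNA (F : Type) [Field F] : Type := MonoidAlgebra F (FreeSemigroup ℕ)

/-- The monomial `x_{a_1} ⋯ x_{a_k}` attached to the list `[a_1, …, a_k]`
(and `0` for the empty list). -/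
def xList (F : Type) [Field F] : List ℕ → FreeNA F
  | [] => 0
  | a :: t => MonoidAlgebra.single (FreeSemigroup.mk a t) 1

/-- `V_m`: the space of multilinear polynomials of degree `m`, spanned by the
monomials `x_{σ(0)} x_{σ(1)} ⋯ x_{σ(m-1)}` for `σ ∈ S_m`. -/
def Vm (F : Type) [Field F] (m : ℕ) : Submodule F (FreeNA F) :=
  Submodule.span F
    (Set.range fun σ : Equiv.Perm (Fin m) =>
      xList F ((List.finRange m).map fun j => (σ j : ℕ)))

/-- A T-ideal: a two-sided ideal of `F⟨X⟩` closed under every algebra endomorphism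
(an algebra endomorphism of the non-unital algebra `F⟨X⟩` being a multiplicative
`F`-linear map). -/
def IsTIdeal (F : Type) [Field F] (I : Submodule F (FreeNA F)) : Prop :=
  (∀ a b : FreeNA F, b ∈ I → a * b ∈ I ∧ b * a ∈ I) ∧
  (∀ ψ : FreeNA F →ₗ[F] FreeNA F, (∀ x y : FreeNA F, ψ (x * y) = ψ x * ψ y) →
    ∀ a ∈ I, ψ a ∈ I)

/-- The smallest T-ideal containing `f`. -/
def TIdealGen (F : Type) [Field F] (f : FreeNA F) : Submodule F (FreeNA F) :=
  sInf {I | IsTIdeal F I ∧ f ∈ I}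

/-- `W_{n,m} = V_m ∩ (x^n)^T`, where `x^n` is the `n`-th power of the variable `x_0`. -/
def Wnm (F : Type) [Field F] (n m : ℕ) : Submodule F (FreeNA F) :=
  Vm F m ⊓ TIdealGen F (xList F (List.replicate n 0))

/-- `A` is an ordered partition of `[m] = {0, …, m-1}` into `n` parts: `n` pairwise
disjoint nonempty duplicate-free lists whose union is `{0, …, m-1}`. -/
def IsOrdPtn (n m : ℕ) (A : Fin n → List ℕ) : Prop :=
  (∀ i, A i ≠ []) ∧ (∀ i, (A i).Nodup) ∧
  (∀ i j, i ≠ j → ∀ a, a ∈ A i → a ∉ A j) ∧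
  (∀ a : ℕ, a < m ↔ ∃ i, a ∈ A i)

/-- `P_O = P_n(x_{A_1}, …, x_{A_n}) = ∑_{σ ∈ S_n} x_{A_{σ(1)}} ⋯ x_{A_{σ(n)}}`. -/
def POrd (F : Type) [Field F] {n : ℕ} (A : Fin n → List ℕ) : FreeNA F :=
  ∑ σ : Equiv.Perm (Fin n), xList F (((List.finRange n).map fun i => A (σ i)).flatten)

open Polynomial in
/-- If a polynomial takes values in a subspace at all scalars of an infinite field,
its coefficients lie in that subspace. -/
theorem Submodule.coeff_mem_of_forall_eval_mem {F R : Type*} [Field F] [Infinite F] [Ring R]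
    [Algebra F R] (N : Submodule F R) (p : R[X])
    (h : ∀ t : F, p.eval (algebraMap F R t) ∈ N) (k : ℕ) : p.coeff k ∈ N := by
  by_contra hk
  obtain ⟨f, hf, hN⟩ := N.exists_le_ker_of_notMem hk
  have h0 : ∑ i ∈ Finset.range (p.natDegree + 1), monomial i (f (p.coeff i)) = 0 := by
    refine Polynomial.funext fun t => ?_
    have := hN (h t)
    rw [LinearMap.mem_ker, eval_eq_sum_range, map_sum] at this
    rw [eval_finsetSum, eval_zero, ← this]
    refine Finset.sum_congr rfl fun i _ => ?_
    rw [eval_monomial, ← map_pow, ← Algebra.commutes, ← Algebra.smul_def, map_smul, smul_eq_mul,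
      mul_comm]
  have h1 := congrArg (coeff · k) h0
  simp only [finsetSum_coeff, coeff_monomial, Finset.sum_ite_eq', Finset.mem_range,
    coeff_zero] at h1
  split_ifs at h1 with hlt
  · exact hf h1
  · exact hf (by rw [coeff_eq_zero_of_natDegree_lt (by omega), map_zero])

open Polynomial in
theorem Polynomial.coeff_one_pow_eq_sum {R : Type*} [Ring R] (p : R[X]) (n : ℕ) :
    (p ^ n).coeff 1 =
      ∑ i ∈ Finset.range n, p.coeff 0 ^ i * p.coeff 1 * p.coeff 0 ^ (n - 1 - i) := by
  induction n with
  | zero => simp [coeff_one]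
  | succ n ih =>
    have h0 : (p ^ n).coeff 0 = p.coeff 0 ^ n := map_pow constantCoeff p n
    rw [pow_succ, mul_coeff_one, h0, ih, Finset.sum_range_succ, Finset.sum_mul, add_comm]
    congr 1
    · refine Finset.sum_congr rfl fun i hi => ?_
      rw [Finset.mem_range] at hi
      rw [mul_assoc, ← pow_succ, show n - 1 - i + 1 = n + 1 - 1 - i by omega]
    · simp

section PowSpan

variable {F A : Type*} [Field F] [NonUnitalRing A] [Module F A] [IsScalarTower F A A]
  [SMulCommClass F A A]

/-- The span of the `n`-th powers of elements of `A`, inside the unitization of `A`. -/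
def powSpan (F A : Type*) [Field F] [NonUnitalRing A] [Module F A] [IsScalarTower F A A]
    [SMulCommClass F A A] (n : ℕ) : Submodule F (Unitization F A) :=
  Submodule.span F (Set.range fun a : A => (a : Unitization F A) ^ n)

theorem inr_pow_mem_powSpan (n : ℕ) (a : A) : (a : Unitization F A) ^ n ∈ powSpan F A n :=
  Submodule.subset_span ⟨a, rfl⟩

open Polynomial in
theorem eval_algebraMap_eq {R : Type*} [Ring R] [Algebra F R] (t : F) (p : R[X]) :
    p.eval (algebraMap F R t) = eval₂RingHom' (RingHom.id R) (algebraMap F R t)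
      (fun a => (Algebra.commutes t a).symm) p := rfl

open Polynomial in
theorem eval_linear_eq_inr (a b : A) (t : F) :
    eval₂RingHom' (RingHom.id (Unitization F A)) (algebraMap F _ t)
      (fun a => (Algebra.commutes t a).symm) 
        (C (a : Unitization F A) + C (b : Unitization F A) * X) =
      ((a + t • b : A) : Unitization F A) := by
  rw [← eval_algebraMap_eq, eval_add, eval_C, eval_C_mul, eval_X, ← Algebra.commutes,
    ← Algebra.smul_def, Unitization.inr_add, Unitization.inr_smul]

variable [Infinite F]

open Polynomial in
theorem sum_pow_mul_pow_mem_powSpan (n : ℕ) (a b : A) :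
    ∑ i ∈ Finset.range n, (a : Unitization F A) ^ i * b * (a : Unitization F A) ^ (n - 1 - i) ∈
      powSpan F A n := by
  have := (powSpan F A n).coeff_mem_of_forall_eval_mem
    ((C (a : Unitization F A) + C (b : Unitization F A) * X) ^ n) (fun t => by
      rw [eval_algebraMap_eq, map_pow, eval_linear_eq_inr]
      exact inr_pow_mem_powSpan n _) 1
  simpa [coeff_one_pow_eq_sum] using this

open Polynomial in
theorem sum_weighted_mem_powSpan (n : ℕ) (a u : A) :
    ∑ i ∈ Finset.range n,
      ((i : Unitization F A) * (a ^ (i + 1) * u * (a : Unitization F A) ^ (n - 1 - i)) +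
        ((n - 1 - i : ℕ) : Unitization F A) * (a ^ i * u * (a : Unitization F A) ^ (n - 1 - i + 1)))
      ∈ powSpan F A n := by
  set q : (Unitization F A)[X] := C (a : Unitization F A) + C ((a * a : A) : Unitization F A) * X
    with hq
  have h0 (i : ℕ) : (q ^ i).coeff 0 = (a : Unitization F A) ^ i := by
    rw [← constantCoeff_apply, map_pow]
    simp [hq]
  have h1 (i : ℕ) : (q ^ i).coeff 1 = (i : Unitization F A) * (a : Unitization F A) ^ (i + 1) := by
    rw [coeff_one_pow_eq_sum, ← nsmul_eq_mul]
    conv_rhs => rw [← Finset.card_range i, ← Finset.sum_const]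
    refine Finset.sum_congr rfl fun j hj => ?_
    rw [Finset.mem_range] at hj
    simp only [hq, coeff_add, coeff_C_zero, mul_coeff_zero, coeff_X_zero, mul_zero, add_zero,
      coeff_C_succ, coeff_C_mul, coeff_X_one, mul_one, zero_add, Unitization.inr_mul]
    rw [← pow_two, ← pow_add, ← pow_add, show j + 2 + (i - 1 - j) = i + 1 by omega,
      Finset.card_range]
  have := (powSpan F A n).coeff_mem_of_forall_eval_mem
    (∑ i ∈ Finset.range n, q ^ i * C (u : Unitization F A) * q ^ (n - 1 - i)) (fun t => by
      rw [eval_algebraMap_eq, map_sum]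
      simp only [map_mul, map_pow, hq, eval_linear_eq_inr]
      simp only [← eval_algebraMap_eq, eval_C]
      exact sum_pow_mul_pow_mem_powSpan n (a + t • (a * a)) u) 1
  rw [finsetSum_coeff] at this
  convert this using 2 with i hi
  rw [mul_coeff_one, mul_coeff_one, mul_coeff_zero, h0, h0, h1, h1, coeff_C_zero, coeff_C_succ,
    mul_zero, zero_add, add_comm]
  congr 1
  · rw [← mul_assoc, (Nat.cast_commute (n - 1 - i) ((a : Unitization F A) ^ i * u)).eq, mul_assoc]
  · simp only [mul_assoc]

theorem mul_inr_pow_mem_powSpan [CharZero F] (n : ℕ) (hn : 1 ≤ n) (a u : A) :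
    (u : Unitization F A) * (a : Unitization F A) ^ n ∈ powSpan F A n ∧
      (a : Unitization F A) ^ n * u ∈ powSpan F A n := by
  set c : ℕ → Unitization F A := fun i =>
    (a : Unitization F A) ^ i * u * (a : Unitization F A) ^ (n - i) with hc
  have hX : ∑ i ∈ Finset.range n, c i ∈ powSpan F A n := by
    convert sum_pow_mul_pow_mem_powSpan (F := F) n a (u * a) using 2 with i hi
    rw [Finset.mem_range] at hi
    rw [Unitization.inr_mul, ← mul_assoc, mul_assoc _ (a : Unitization F A), ← pow_succ',
      show n - 1 - i + 1 = n - i by omega]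
  have hY : ∑ i ∈ Finset.range n, c (i + 1) ∈ powSpan F A n := by
    convert sum_pow_mul_pow_mem_powSpan (F := F) n a (a * u) using 2 with i hi
    rw [Unitization.inr_mul, ← mul_assoc, ← pow_succ, show n - 1 - i = n - (i + 1) by omega]
  have hZ : ∑ i ∈ Finset.range n, ((i : F) • c (i + 1) + ((n - 1 - i : ℕ) : F) • c i) ∈
      powSpan F A n := by
    convert sum_weighted_mem_powSpan (F := F) n a u using 2 with i hi
    rw [Finset.mem_range] at hi
    simp only [hc, Nat.cast_smul_eq_nsmul, nsmul_eq_mul]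
    rw [show n - 1 - i + 1 = n - i by omega, show n - 1 - i = n - (i + 1) by omega]
  have hsum : ∑ i ∈ Finset.range n, c i + ∑ i ∈ Finset.range n, c (i + 1) +
      ∑ i ∈ Finset.range n, ((i : F) • c (i + 1) + ((n - 1 - i : ℕ) : F) • c i) =
      (n : F) • ∑ i ∈ Finset.range (n + 1), c i := by
    have h1 : ∑ i ∈ Finset.range (n + 1), (i : F) • c i =
        ∑ i ∈ Finset.range n, ((i : F) + 1) • c (i + 1) := by
      simp [Finset.sum_range_succ']
    have h2 : ∑ i ∈ Finset.range (n + 1), ((n : F) - i) • c i =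
        ∑ i ∈ Finset.range n, ((n : F) - i) • c i := by
      simp [Finset.sum_range_succ]
    have h3 : (n : F) • ∑ i ∈ Finset.range (n + 1), c i =
        ∑ i ∈ Finset.range (n + 1), (i : F) • c i +
          ∑ i ∈ Finset.range (n + 1), ((n : F) - i) • c i := by
      rw [← Finset.sum_add_distrib, Finset.smul_sum]
      exact Finset.sum_congr rfl fun i _ => by rw [← add_smul]; congr 1; ring
    rw [h3, h1, h2, ← Finset.sum_add_distrib, ← Finset.sum_add_distrib, ← Finset.sum_add_distrib]
    refine Finset.sum_congr rfl fun i hi => ?_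
    rw [Finset.mem_range] at hi
    have : ((n - 1 - i : ℕ) : F) = n - i - 1 := by
      rw [show n - 1 - i = n - (i + 1) by omega, Nat.cast_sub (by omega)]; push_cast; ring
    rw [this]
    module
  have hS : ∑ i ∈ Finset.range (n + 1), c i ∈ powSpan F A n := by
    have hn0 : (n : F) ≠ 0 := Nat.cast_ne_zero.2 (by omega)
    refine ((powSpan F A n).smul_mem_iff hn0).1 ?_
    rw [← hsum]
    exact add_mem (add_mem hX hY) hZ
  constructor
  · rw [Finset.sum_range_succ'] at hS
    simpa [hc] using (Submodule.add_mem_iff_right _ hY).1 hS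
  · rw [Finset.sum_range_succ] at hS
    simpa [hc] using (Submodule.add_mem_iff_right _ hX).1 hS

theorem mul_mem_powSpan [CharZero F] {n : ℕ} (hn : 1 ≤ n) (u : A) {x : Unitization F A}
    (hx : x ∈ powSpan F A n) :
    (u : Unitization F A) * x ∈ powSpan F A n ∧ x * u ∈ powSpan F A n := by
  induction hx using Submodule.span_induction with
  | mem x hx =>
    obtain ⟨a, rfl⟩ := hx
    exact mul_inr_pow_mem_powSpan n hn a u
  | zero => simp
  | add x y _ _ hx hy =>
    rw [mul_add, add_mul]
    exact ⟨add_mem hx.1 hy.1, add_mem hx.2 hy.2⟩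
  | smul c x _ hx =>
    rw [mul_smul_comm, smul_mul_assoc]
    exact ⟨Submodule.smul_mem _ c hx.1, Submodule.smul_mem _ c hx.2⟩

end PowSpan

/-- Polarization: the symmetrization of a multilinear map is a signed sum of its
values on the diagonal. -/
theorem MultilinearMap.sum_perm_eq_sum_diagonal {F ι M M' : Type*} [CommRing F] [Fintype ι]
    [DecidableEq ι] [AddCommGroup M] [Module F M] [AddCommGroup M'] [Module F M']
    (f : MultilinearMap F (fun _ : ι => M) M') (z : ι → M) :
    ∑ σ : Equiv.Perm ι, f (fun i => z (σ i)) =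
      ∑ S : Finset ι, (-1 : F) ^ Sᶜ.card • f (fun _ => ∑ i ∈ S, z i) := by
  have hexp (S : Finset ι) : f (fun _ => ∑ i ∈ S, z i) =
      ∑ r : ι → ι, (if ∀ j, r j ∈ S then (1 : F) else 0) • f (fun i => z (r i)) := by
    rw [f.map_sum_finset (fun _ i => z i) (fun _ => S)]
    simp only [ite_smul, one_smul, zero_smul]
    rw [← Finset.sum_filter]
    refine Finset.sum_congr ?_ fun _ _ => rfl
    ext r
    simp
  have hcoef (r : ι → ι) :
      ∑ S : Finset ι, (-1 : F) ^ Sᶜ.card * (if ∀ j, r j ∈ S then (1 : F) else 0) =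
        if Function.Surjective r then 1 else 0 := by
    have h := Fintype.prod_add (fun _ : ι => (1 : F))
      (fun i => if ∃ j, r j = i then (0 : F) else -1)
    have hl : ∏ i, ((1 : F) + if ∃ j, r j = i then (0 : F) else -1) =
        if Function.Surjective r then 1 else 0 := by
      split_ifs with hr
      · exact Finset.prod_eq_one fun i _ => by rw [if_pos (hr i), add_zero]
      · obtain ⟨i, hi⟩ := not_forall.1 hr
        exact Finset.prod_eq_zero (Finset.mem_univ i) (by rw [if_neg hi]; ring)
    rw [← hl, h]
    refine Finset.sum_congr rfl fun S _ => ?_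
    rw [Finset.prod_const_one, one_mul]
    split_ifs with hS
    · rw [mul_one, ← Finset.prod_const]
      refine Finset.prod_congr rfl fun i hi => ?_
      rw [if_neg]
      rintro ⟨j, rfl⟩
      exact Finset.mem_compl.1 hi (hS j)
    · obtain ⟨j, hj⟩ := not_forall.1 hS
      rw [mul_zero, eq_comm]
      exact Finset.prod_eq_zero (Finset.mem_compl.2 hj) (if_pos ⟨j, rfl⟩)
  simp only [hexp, Finset.smul_sum, smul_smul]
  rw [Finset.sum_comm]
  simp only [← Finset.sum_smul, hcoef]
  refine Finset.sum_of_injOn (fun σ : Equiv.Perm ι => (σ : ι → ι))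
    (fun σ _ τ _ h => Equiv.coe_fn_injective h) (fun _ _ => Finset.mem_coe.2 (Finset.mem_univ _))
    (fun r _ hr => ?_) (fun σ _ => ?_)
  · rw [if_neg, zero_smul]
    intro hs
    exact hr ⟨Equiv.ofBijective r (Finite.surjective_iff_bijective.1 hs),
      Finset.mem_coe.2 (Finset.mem_univ _), rfl⟩
  · rw [if_pos σ.surjective, one_smul]

/-- The symmetrized product `∑ σ, z (σ 0) ⋯ z (σ (n - 1))` as a multilinear map from a
non-unital algebra to its unitization. -/
def symProd (F A : Type*) [Field F] [NonUnitalRing A] [Module F A] [IsScalarTower F A A]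
    [SMulCommClass F A A] (n : ℕ) : MultilinearMap F (fun _ : Fin n => A) (Unitization F A) :=
  ∑ σ : Equiv.Perm (Fin n),
    ((MultilinearMap.mkPiAlgebraFin F n (Unitization F A)).compLinearMap
      fun _ => Unitization.inrHom F F A).domDomCongr σ

section SymProd

variable {F A : Type*} [Field F] [NonUnitalRing A] [Module F A] [IsScalarTower F A A]
  [SMulCommClass F A A]

theorem symProd_apply (n : ℕ) (z : Fin n → A) :
    symProd F A n z = ∑ σ : Equiv.Perm (Fin n),
      ((List.finRange n).map fun i => (z (σ i) : Unitization F A)).prod := by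
  simp [symProd, List.ofFn_eq_map]

theorem symProd_const (n : ℕ) (a : A) :
    symProd F A n (fun _ => a) = (n.factorial : F) • (a : Unitization F A) ^ n := by
  simp [symProd_apply, Fintype.card_perm, Nat.cast_smul_eq_nsmul]

theorem symProd_mem_powSpan (n : ℕ) (z : Fin n → A) : symProd F A n z ∈ powSpan F A n := by
  have h := ((MultilinearMap.mkPiAlgebraFin F n (Unitization F A)).compLinearMap
    fun _ => Unitization.inrHom F F A).sum_perm_eq_sum_diagonal z
  have h' : symProd F A n z = ∑ σ : Equiv.Perm (Fin n),
      ((MultilinearMap.mkPiAlgebraFin F n (Unitization F A)).compLinearMap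
        fun _ => Unitization.inrHom F F A) fun i => z (σ i) := by
    simp [symProd]
  rw [h', h]
  refine Submodule.sum_mem _ fun S _ => Submodule.smul_mem _ _ ?_
  rw [MultilinearMap.compLinearMap_apply, MultilinearMap.mkPiAlgebraFin_apply_const]
  exact inr_pow_mem_powSpan n _

end SymProd

section FreeAlgebra

variable {F : Type} [Field F]

theorem inr_xList {l : List ℕ} (hl : l ≠ []) :
    ((xList F l : FreeNA F) : Unitization F (FreeNA F)) =
      (l.map fun a => ((xList F [a] : FreeNA F) : Unitization F (FreeNA F))).prod := by
  induction l with
  | nil => exact absurd rfl hl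
  | cons a t ih =>
    cases t with
    | nil => simp
    | cons b t =>
      rw [List.map_cons, List.prod_cons, ← ih (List.cons_ne_nil _ _), ← Unitization.inr_mul]
      simp only [xList, MonoidAlgebra.single_mul_single, mul_one]
      rfl

theorem inr_xList_flatten {L : List (List ℕ)} (hL : L ≠ []) (h : ∀ l ∈ L, l ≠ []) :
    ((xList F L.flatten : FreeNA F) : Unitization F (FreeNA F)) =
      (L.map fun l => ((xList F l : FreeNA F) : Unitization F (FreeNA F))).prod := by
  have hne : L.flatten ≠ [] := by
    obtain ⟨l, hl⟩ := List.exists_mem_of_ne_nil L hL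
    exact fun h0 => h l hl (List.flatten_eq_nil_iff.1 h0 l hl)
  rw [inr_xList hne, List.map_flatten, List.prod_flatten, List.map_map]
  exact congrArg List.prod (List.map_congr_left fun l hl => (inr_xList (h l hl)).symm)

theorem inr_POrd {n : ℕ} (hn : 1 ≤ n) (A : Fin n → List ℕ) (hA : ∀ i, A i ≠ []) :
    ((POrd F A : FreeNA F) : Unitization F (FreeNA F)) =
      symProd F (FreeNA F) n fun i => xList F (A i) := by
  rw [symProd_apply, POrd, ← Unitization.inrHom_apply F F (FreeNA F), map_sum]
  refine Finset.sum_congr rfl fun σ _ => ?_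
  rw [Unitization.inrHom_apply, inr_xList_flatten _ (by simpa using fun i => hA (σ i)),
    List.map_map]
  · rfl
  · rw [← List.length_pos_iff]
    simp; omega

theorem inr_xList_replicate {n : ℕ} (hn : 1 ≤ n) (a : ℕ) :
    ((xList F (List.replicate n a) : FreeNA F) : Unitization F (FreeNA F)) =
      ((xList F [a] : FreeNA F) : Unitization F (FreeNA F)) ^ n := by
  rw [inr_xList (by rw [← List.length_pos_iff]; simp; omega)]
  simp

/-- The algebra endomorphism of the unitization extending a non-unital endomorphism. -/
def unitizationMap (ψ : FreeNA F →ₙₐ[F] FreeNA F) :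
    Unitization F (FreeNA F) →ₐ[F] Unitization F (FreeNA F) :=
  Unitization.lift ((Unitization.inrNonUnitalAlgHom F (FreeNA F)).comp ψ)

theorem unitizationMap_inr (ψ : FreeNA F →ₙₐ[F] FreeNA F) (a : FreeNA F) :
    unitizationMap ψ (a : Unitization F (FreeNA F)) = (ψ a : FreeNA F) := by
  simp [unitizationMap]

theorem unitizationMap_mem_powSpan (ψ : FreeNA F →ₙₐ[F] FreeNA F) {n : ℕ}
    {x : Unitization F (FreeNA F)} (hx : x ∈ powSpan F (FreeNA F) n) :
    unitizationMap ψ x ∈ powSpan F (FreeNA F) n := by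
  have h : powSpan F (FreeNA F) n ≤
      (powSpan F (FreeNA F) n).comap (unitizationMap ψ).toLinearMap := by
    refine Submodule.span_le.2 ?_
    rintro _ ⟨a, rfl⟩
    simpa [unitizationMap_inr] using inr_pow_mem_powSpan n (ψ a)
  exact h hx

theorem isTIdeal_comap_powSpan [CharZero F] {n : ℕ} (hn : 1 ≤ n) :
    IsTIdeal F ((powSpan F (FreeNA F) n).comap (Unitization.inrHom F F (FreeNA F))) := by
  refine ⟨fun a b hb => ?_, fun ψ hψ a ha => ?_⟩
  · have := mul_mem_powSpan hn a (Submodule.mem_comap.1 hb)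
    simpa using this
  · have := unitizationMap_mem_powSpan
      ({ ψ with map_zero' := map_zero ψ, map_mul' := hψ } : FreeNA F →ₙₐ[F] FreeNA F)
      (Submodule.mem_comap.1 ha)
    rw [Unitization.inrHom_apply, unitizationMap_inr] at this
    exact this

theorem inr_mem_powSpan_of_mem_TIdealGen [CharZero F] {n : ℕ} (hn : 1 ≤ n) {y : FreeNA F}
    (hy : y ∈ TIdealGen F (xList F (List.replicate n 0))) :
    (y : Unitization F (FreeNA F)) ∈ powSpan F (FreeNA F) n := by
  refine Submodule.mem_sInf.1 hy _ ⟨isTIdeal_comap_powSpan hn, ?_⟩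
  rw [Submodule.mem_comap, Unitization.inrHom_apply, inr_xList_replicate hn]
  exact inr_pow_mem_powSpan n _

theorem snd_mem_TIdealGen_of_mem_powSpan {n : ℕ} (hn : 1 ≤ n) {x : Unitization F (FreeNA F)}
    (hx : x ∈ powSpan F (FreeNA F) n) :
    x.snd ∈ TIdealGen F (xList F (List.replicate n 0)) := by
  have h : powSpan F (FreeNA F) n ≤ (TIdealGen F (xList F (List.replicate n 0))).comap
      (Unitization.sndHom F F (FreeNA F)) := by
    refine Submodule.span_le.2 ?_
    rintro _ ⟨a, rfl⟩
    refine Submodule.mem_sInf.2 fun I hI => ?_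
    let ψ : FreeNA F →ₙₐ[F] FreeNA F := MonoidAlgebra.liftMagma F (FreeSemigroup.lift fun _ => a)
    have hψ : ψ (xList F [0]) = a := by
      simp only [ψ, xList, MonoidAlgebra.liftMagma_apply_apply]
      simp [FreeSemigroup.lift]
    have h1 := hI.1.2 ψ (map_mul ψ) _ hI.2
    have h2 := unitizationMap_inr ψ (xList F (List.replicate n 0))
    rw [inr_xList_replicate hn, map_pow, unitizationMap_inr, hψ] at h2
    change ((a : Unitization F (FreeNA F)) ^ n).snd ∈ I
    rw [h2, Unitization.snd_inr]
    exact h1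
  exact h hx

/-- The projection onto multilinear polynomials of degree `m`, killing all other monomials. -/
def multilinearProj (F : Type) [Field F] (m : ℕ) : FreeNA F →ₗ[F] FreeNA F :=
  (MonoidAlgebra.basis (FreeSemigroup ℕ) F).constr F fun w =>
    if (w.head :: w.tail).Perm (List.range m) then MonoidAlgebra.single w 1 else 0

theorem multilinearProj_xList (m : ℕ) (l : List ℕ) :
    multilinearProj F m (xList F l) = if l.Perm (List.range m) then xList F l else 0 := by
  cases l with
  | nil => simp [xList]
  | cons a t =>
    rw [xList, ← MonoidAlgebra.basis_apply, multilinearProj, Module.Basis.constr_basis]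
    simp

theorem multilinearProj_of_mem_Vm {m : ℕ} {y : FreeNA F} (hy : y ∈ Vm F m) :
    multilinearProj F m y = y := by
  have h : Vm F m ≤ LinearMap.eqLocus (multilinearProj F m) LinearMap.id := by
    refine Submodule.span_le.2 ?_
    rintro _ ⟨σ, rfl⟩
    simp only [SetLike.mem_coe, LinearMap.mem_eqLocus, LinearMap.id_apply]
    rw [multilinearProj_xList, if_pos]
    rw [List.perm_ext_iff_of_nodup _ List.nodup_range]
    · intro a
      simp only [List.mem_map, List.mem_finRange, true_and, List.mem_range]
      exact ⟨fun ⟨j, hj⟩ => hj ▸ (σ j).2, fun ha => ⟨σ.symm ⟨a, ha⟩, by simp⟩⟩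
    · exact (List.nodup_finRange m).map (Fin.val_injective.comp σ.injective)
  exact h hy

theorem xList_mem_Vm {m : ℕ} {l : List ℕ} (hl : l.Perm (List.range m)) : xList F l ∈ Vm F m := by
  have hlen : l.length = m := by simpa using hl.length_eq
  have hlt (j : Fin m) : l[(j : ℕ)]'(by omega) < m :=
    List.mem_range.1 (hl.mem_iff.1 (List.getElem_mem _))
  have hnd : l.Nodup := hl.nodup_iff.2 List.nodup_range
  let f : Fin m → Fin m := fun j => ⟨l[(j : ℕ)]'(by omega), hlt j⟩
  have hf : Function.Injective f := fun i j hij =>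
    Fin.ext ((hnd.getElem_inj_iff).1 (congrArg Fin.val hij))
  refine Submodule.subset_span
    ⟨Equiv.ofBijective f (Finite.injective_iff_bijective.1 hf), congrArg (xList F) ?_⟩
  refine List.ext_getElem (by simp [hlen]) fun i h1 h2 => ?_
  simp [f]

theorem flatten_perm (n : ℕ) (A : Fin n → List ℕ) (σ : Equiv.Perm (Fin n)) :
    ((List.finRange n).map fun i => A (σ i)).flatten.Perm ((List.finRange n).map A).flatten := by
  refine List.Perm.flatten ?_
  have h : ((List.finRange n).map σ).Perm (List.finRange n) := by
    rw [List.perm_ext_iff_of_nodup ((List.nodup_finRange n).map σ.injective)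
      (List.nodup_finRange n)]
    exact fun a => by simpa using ⟨σ.symm a, by simp⟩
  simpa [List.map_map, Function.comp_def] using h.map A

theorem isOrdPtn_iff {n m : ℕ} {A : Fin n → List ℕ} (hA : ∀ i, A i ≠ []) :
    IsOrdPtn n m A ↔ ((List.finRange n).map A).flatten.Perm (List.range m) := by
  have hmem (a : ℕ) : a ∈ ((List.finRange n).map A).flatten ↔ ∃ i, a ∈ A i := by simp
  have hnodup : ((List.finRange n).map A).flatten.Nodup ↔
      (∀ i, (A i).Nodup) ∧ ∀ i j, i ≠ j → ∀ a, a ∈ A i → a ∉ A j := by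
    rw [List.nodup_flatten, List.pairwise_map]
    refine and_congr (by simp) ?_
    constructor
    · intro h i j hij a hi hj
      have : Std.Symm fun a b => (A a).Disjoint (A b) := ⟨fun _ _ h => h.symm⟩
      exact (h.forall (List.mem_finRange i) (List.mem_finRange j) hij) hi hj
    · intro h
      exact (List.nodup_finRange n).imp fun {i j} hij a hi hj => h i j hij a hi hj
  constructor
  · rintro ⟨-, h1, h2, h3⟩
    rw [List.perm_ext_iff_of_nodup (hnodup.2 ⟨h1, h2⟩) List.nodup_range]
    exact fun a => by rw [hmem, List.mem_range, h3]
  · intro h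
    obtain ⟨h1, h2⟩ := hnodup.1 (h.nodup_iff.2 List.nodup_range)
    exact ⟨hA, h1, h2, fun a => by rw [← hmem, h.mem_iff, List.mem_range]⟩

theorem multilinearProj_POrd (m : ℕ) {n : ℕ} (A : Fin n → List ℕ) :
    multilinearProj F m (POrd F A) =
      if ((List.finRange n).map A).flatten.Perm (List.range m) then POrd F A else 0 := by
  rw [POrd, map_sum]
  simp only [multilinearProj_xList]
  split_ifs with h
  · exact Finset.sum_congr rfl fun σ _ => if_pos ((flatten_perm n A σ).trans h)
  · exact Finset.sum_eq_zero fun σ _ => if_neg fun h' => h ((flatten_perm n A σ).symm.trans h')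

theorem multilinearProj_snd_symProd_mem {n : ℕ} (hn : 1 ≤ n) (m : ℕ) (z : Fin n → FreeNA F) :
    multilinearProj F m (symProd F (FreeNA F) n z).snd ∈ Submodule.span F
      {P : FreeNA F | ∃ A : Fin n → List ℕ, IsOrdPtn n m A ∧ P = POrd F A} := by
  set N := Submodule.span F
    {P : FreeNA F | ∃ A : Fin n → List ℕ, IsOrdPtn n m A ∧ P = POrd F A}
  have h : (N.mkQ ∘ₗ multilinearProj F m ∘ₗ
      Unitization.sndHom F F (FreeNA F)).compMultilinearMap (symProd F (FreeNA F) n) = 0 := by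
    refine Module.Basis.ext_multilinear
      (fun _ => MonoidAlgebra.basis (FreeSemigroup ℕ) F) fun w => ?_
    have hw : (fun i => MonoidAlgebra.basis (FreeSemigroup ℕ) F (w i)) =
        fun i => xList F ((w i).head :: (w i).tail) := rfl
    have hne (i : Fin n) : (w i).head :: (w i).tail ≠ [] := List.cons_ne_nil _ _
    rw [hw, LinearMap.compMultilinearMap_apply, ← inr_POrd hn _ hne]
    simp only [LinearMap.comp_apply, Unitization.sndHom_apply, Unitization.snd_inr,
      zero_apply, multilinearProj_POrd, Submodule.mkQ_apply,
      Submodule.Quotient.mk_eq_zero]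
    split_ifs with hp
    · exact Submodule.subset_span ⟨_, (isOrdPtn_iff hne).2 hp, rfl⟩
    · exact N.zero_mem
  have := congrArg (fun g => g z) h
  simpa [Submodule.Quotient.mk_eq_zero] using this

theorem multilinearProj_snd_mem [CharZero F] {n : ℕ} (hn : 1 ≤ n) (m : ℕ)
    {x : Unitization F (FreeNA F)} (hx : x ∈ powSpan F (FreeNA F) n) :
    multilinearProj F m x.snd ∈ Submodule.span F
      {P : FreeNA F | ∃ A : Fin n → List ℕ, IsOrdPtn n m A ∧ P = POrd F A} := by
  set N := Submodule.span F
    {P : FreeNA F | ∃ A : Fin n → List ℕ, IsOrdPtn n m A ∧ P = POrd F A} with hN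
  have h : powSpan F (FreeNA F) n ≤
      N.comap (multilinearProj F m ∘ₗ Unitization.sndHom F F (FreeNA F)) := by
    refine Submodule.span_le.2 ?_
    rintro _ ⟨a, rfl⟩
    have h1 := multilinearProj_snd_symProd_mem hn m fun _ => a
    rw [symProd_const, Unitization.snd_smul, map_smul, ← hN,
      N.smul_mem_iff (Nat.cast_ne_zero.2 n.factorial_ne_zero)] at h1
    exact h1
  exact h hx

end FreeAlgebra

/-- `W_{n,m}` is spanned by the polynomials `P_O`, `O ∈ Ω_{n,m}`. -/
theorem Wnm_eq_span_POrd (F : Type) [Field F] [CharZero F] (n m : ℕ)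
    (hn : 1 ≤ n) (hnm : n ≤ m) :
    Wnm F n m = Submodule.span F
      {P : FreeNA F | ∃ A : Fin n → List ℕ, IsOrdPtn n m A ∧ P = POrd F A} := by
  apply le_antisymm
  · rintro y ⟨hV, hT⟩
    have := multilinearProj_snd_mem hn m (inr_mem_powSpan_of_mem_TIdealGen hn hT)
    rwa [Unitization.snd_inr, multilinearProj_of_mem_Vm hV] at this
  · refine Submodule.span_le.2 ?_
    rintro _ ⟨A, hA, rfl⟩
    refine ⟨Submodule.sum_mem _ fun σ _ =>
      xList_mem_Vm ((flatten_perm n A σ).trans ((isOrdPtn_iff hA.1).1 hA)), ?_⟩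
    have := snd_mem_TIdealGen_of_mem_powSpan hn
      (symProd_mem_powSpan (F := F) n fun i => xList F (A i))
    rwa [← inr_POrd hn A hA.1, Unitization.snd_inr] at this

end
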